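/- arXiv:math/0506042 — 2 statements merged into one kernel-verified Lean document; each statement's English description precedes it below -/
import Mathlib

section
/- Let γ : [0,1] → ℝ² ∖ {0} be a closed curve (γ(0) = γ(1)) whose winding number (degree) around 0 is strictly greater than 1. Then there exist real numbers t₁ < t₂ in [0,1] such that γ(t₁) = γ(t₂) and the restriction of γ to [t₁, t₂] is a closed curve of degree 1 around 0. -/
open Set

/-- A curve `γ` (defined on `[0,1]`) with values in `ℂ ∖ {0}` has degree `n` around `0`
if it lifts through the covering `exp : ℂ → ℂ ∖ {0}` to a path whose endpoints differ
by `2πin`. -/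
def HasDeg (γ : ℝ → ℂ) (n : ℤ) : Prop :=
  ∃ g : ℝ → ℂ, ContinuousOn g (Icc 0 1) ∧
    (∀ t ∈ Icc (0:ℝ) 1, γ t = Complex.exp (g t)) ∧
    g 1 - g 0 = ((2 * Real.pi * (n : ℝ) : ℝ) : ℂ) * Complex.I

/-- A path in the closed lower half plane from the negative to the positive real axis
turns by the angle `π`. -/
lemma half_turn (θ : ℝ → ℝ) (hθ : Continuous θ) (hs : ∀ u, Real.sin (θ u) ≤ 0) (x y : ℝ)
    (hx : Real.cos (θ x) < 0) (hx0 : Real.sin (θ x) = 0)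
    (hy : 0 < Real.cos (θ y)) (hy0 : Real.sin (θ y) = 0) : θ y - θ x = Real.pi := by
  have hpi := Real.pi_pos
  have hx1 : Real.cos (θ x) = -1 := by
    have := Real.sin_sq_add_cos_sq (θ x)
    rw [hx0] at this
    nlinarith
  set φ : ℝ → ℝ := fun u => θ u - θ x + Real.pi with hφ
  have hφc : Continuous φ := by fun_prop
  have hsin : ∀ u, Real.sin (φ u) = Real.sin (θ u) := by
    intro u
    simp only [hφ, Real.sin_add_pi, Real.sin_sub, hx0, hx1]
    ring
  have hcos : ∀ u, Real.cos (φ u) = Real.cos (θ u) := by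
    intro u
    simp only [hφ, Real.cos_add_pi, Real.cos_sub, hx0, hx1]
    ring
  have hφx : φ x = Real.pi := by simp [hφ]
  have hlo : Real.pi ≤ φ y := by
    by_contra! h
    obtain ⟨z, hz⟩ := mem_range_of_exists_le_of_exists_ge hφc
      (c := max (φ y) (Real.pi / 2)) ⟨y, le_max_left _ _⟩
      ⟨x, by rw [hφx]; exact max_le h.le (by linarith)⟩
    have h1 : 0 < Real.sin (φ z) := by
      rw [hz]
      apply Real.sin_pos_of_pos_of_lt_pi
      · exact lt_of_lt_of_le (by linarith) (le_max_right _ _)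
      · exact max_lt h (by linarith)
    have := hs z
    rw [hsin] at h1
    linarith
  have hhi : φ y ≤ 2 * Real.pi := by
    by_contra! h
    obtain ⟨z, hz⟩ := mem_range_of_exists_le_of_exists_ge hφc
      (c := min (φ y) (5 * Real.pi / 2)) ⟨x, by rw [hφx]; exact le_min hlo (by linarith)⟩
      ⟨y, min_le_left _ _⟩
    have h1 : 0 < Real.sin (φ z) := by
      rw [hz, ← Real.sin_sub_two_pi]
      apply Real.sin_pos_of_pos_of_lt_pi
      · have : 2 * Real.pi < min (φ y) (5 * Real.pi / 2) := lt_min h (by linarith)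
        linarith
      · have := min_le_right (φ y) (5 * Real.pi / 2)
        linarith
    have := hs z
    rw [hsin] at h1
    linarith
  have hfin : φ y = 2 * Real.pi := by
    by_contra hne
    have hlt : φ y < 2 * Real.pi := lt_of_le_of_ne hhi hne
    rcases hlo.eq_or_lt with h | h
    · have := hcos y
      rw [← h, Real.cos_pi] at this
      linarith
    · have h1 : Real.sin (φ y - 2 * Real.pi) < 0 :=
        Real.sin_neg_of_neg_of_neg_pi_lt (by linarith) (by linarith)
      rw [Real.sin_sub_two_pi, hsin, hy0] at h1
      exact lt_irrefl _ h1
  simp only [hφ] at hfin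
  linarith

/-- A nonvanishing continuous function on the plane has a continuous logarithm. -/
lemma exists_log (F : ℝ × ℝ → ℂ) (hF : Continuous F) (h0 : ∀ x, F x ≠ 0) :
    ∃ L : ℝ × ℝ → ℂ, Continuous L ∧ ∀ x, Complex.exp (L x) = F x := by
  obtain ⟨L, ⟨-, hL⟩, -⟩ := Complex.isCoveringMapOn_exp.existsUnique_continuousMap_lifts
    (⟨F, hF⟩ : C(ℝ × ℝ, ℂ)) (a₀ := (0, 0)) (e₀ := Complex.log (F (0, 0)))
    (Complex.exp_log (h0 _)) (fun a => h0 a)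
  exact ⟨L, L.continuous, fun x => congrFun hL x⟩

/-- Homotopy obstruction: a family of paths from a fixed negative real to a fixed positive real
in the punctured plane cannot contain both a path in the lower and one in the upper half plane. -/
lemma no_family (F : ℝ × ℝ → ℂ) (hF : Continuous F) (h0 : ∀ x, F x ≠ 0) (d p q : ℝ)
    (A B : ℝ) (hA : A < 0) (hB : 0 < B)
    (hstart : ∀ s, F (s, 0) = A) (hend : ∀ s, F (s, d) = B)
    (hp : ∀ u, (F (p, u)).im ≤ 0) (hq : ∀ u, 0 ≤ (F (q, u)).im) : False := by
  have hpi := Real.pi_pos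
  obtain ⟨L, hLc, hL⟩ := exists_log F hF h0
  have him : ∀ x, (F x).im = Real.exp (L x).re * Real.sin (L x).im := fun x => by
    rw [← hL, Complex.exp_im]
  have hre : ∀ x, (F x).re = Real.exp (L x).re * Real.cos (L x).im := fun x => by
    rw [← hL, Complex.exp_re]
  have hcA : ∀ s, Real.cos (L (s, 0)).im < 0 := fun s => by
    have h := hre (s, 0)
    rw [hstart, Complex.ofReal_re] at h
    have := Real.exp_pos (L (s, 0)).re
    by_contra! h'
    nlinarith [mul_nonneg this.le h']
  have hsA : ∀ s, Real.sin (L (s, 0)).im = 0 := fun s => by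
    have h := him (s, 0)
    rw [hstart, Complex.ofReal_im] at h
    have := Real.exp_pos (L (s, 0)).re
    rcases mul_eq_zero.1 h.symm with h | h
    · linarith
    · exact h
  have hcB : ∀ s, 0 < Real.cos (L (s, d)).im := fun s => by
    have h := hre (s, d)
    rw [hend, Complex.ofReal_re] at h
    have := Real.exp_pos (L (s, d)).re
    by_contra! h'
    nlinarith [mul_nonneg this.le (neg_nonneg.2 h')]
  have hsB : ∀ s, Real.sin (L (s, d)).im = 0 := fun s => by
    have h := him (s, d)
    rw [hend, Complex.ofReal_im] at h
    have := Real.exp_pos (L (s, d)).re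
    rcases mul_eq_zero.1 h.symm with h | h
    · linarith
    · exact h
  have hP := half_turn (fun u => (L (p, u)).im) (by fun_prop) (fun u => by
    have h := hp u
    rw [him] at h
    by_contra! h'
    have := mul_pos (Real.exp_pos (L (p, u)).re) h'
    linarith) 0 d (hcA p) (hsA p) (hcB p) (hsB p)
  have hQ := half_turn (fun u => -(L (q, u)).im) (by fun_prop) (fun u => by
    have h := hq u
    rw [him] at h
    rw [Real.sin_neg]
    by_contra! h'
    have := mul_pos (Real.exp_pos (L (q, u)).re) h'
    linarith) 0 d (by simpa using hcA q) (by simpa using hsA q) (by simpa using hcB q)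
      (by simpa using hsB q)
  obtain ⟨s, hs⟩ := mem_range_of_exists_le_of_exists_ge
    (f := fun s => (L (s, d)).im - (L (s, 0)).im) (by fun_prop) (c := 0)
    ⟨q, by linarith⟩ ⟨p, by linarith⟩
  have h1 : (L (s, d)).im = (L (s, 0)).im := by dsimp only at hs; linarith
  have h2 := hcB s
  have h3 := hcA s
  rw [h1] at h2
  linarith

/-- A path with total displacement `n ≥ 2` has an ordered chord equal to `1` or `n - 1`. -/
lemma chord_step (g : ℝ → ℂ) (hg : Continuous g) (a b : ℝ) (hab : a < b) (n : ℕ) (hn : 2 ≤ n)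
    (h : g b - g a = n) :
    ∃ s t, a ≤ s ∧ s < t ∧ t ≤ b ∧ (g t - g s = 1 ∨ g t - g s = ((n - 1 : ℕ) : ℂ)) := by
  by_contra! hno
  have hn1 : ((n - 1 : ℕ) : ℂ) = n - 1 := by
    rw [Nat.cast_sub (by omega)]; simp
  set G : ℝ → ℂ := fun x => g (min x b) + g (max x b - (b - a)) - g a with hG
  have hGc : Continuous G := by fun_prop
  have hG1 : ∀ x, x ≤ b → G x = g x := fun x hx => by simp [hG, hx]
  have hG2 : ∀ x, b ≤ x → G x = g (x - (b - a)) + n := fun x hx => by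
    simp only [hG, min_eq_right hx, max_eq_left hx, ← h]
    ring
  -- clamps
  set cs : ℝ → ℝ := fun s => max a (min s b) with hcs
  set cu : ℝ → ℝ := fun u => max 0 (min u (b - a)) with hcu
  have hcs1 : ∀ s, a ≤ cs s := fun s => le_max_left _ _
  have hcs2 : ∀ s, cs s ≤ b := fun s => max_le hab.le (min_le_right _ _)
  have hcu1 : ∀ s, 0 ≤ cu s := fun s => le_max_left _ _
  have hcu2 : ∀ s, cu s ≤ b - a := fun s => max_le (by linarith) (min_le_right _ _)
  have hcs3 : ∀ s, a ≤ s → s ≤ b → cs s = s := fun s h1 h2 => by simp [hcs, h1, h2]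
  have hcu3 : cu 0 = 0 := by simp [hcu, hab.le]
  have hcu4 : cu (b - a) = b - a := by simp [hcu, hab.le]
  have hcsc : Continuous cs := by fun_prop
  have hcuc : Continuous cu := by fun_prop
  obtain ⟨p, hp, hpmax⟩ := isCompact_Icc.exists_isMaxOn (nonempty_Icc.2 hab.le)
    (Complex.continuous_im.comp hg).continuousOn
  obtain ⟨q, hq, hqmin⟩ := isCompact_Icc.exists_isMinOn (nonempty_Icc.2 hab.le)
    (Complex.continuous_im.comp hg).continuousOn
  have hpm : ∀ x, a ≤ x → x ≤ b → (g x).im ≤ (g p).im := fun x h1 h2 => hpmax ⟨h1, h2⟩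
  have hqm : ∀ x, a ≤ x → x ≤ b → (g q).im ≤ (g x).im := fun x h1 h2 => hqmin ⟨h1, h2⟩
  have hGim : ∀ x, a ≤ x → x ≤ b + (b - a) → (G x).im ≤ (g p).im ∧ (g q).im ≤ (G x).im := by
    intro x h1 h2
    rcases le_total x b with h3 | h3
    · rw [hG1 x h3]; exact ⟨hpm x h1 h3, hqm x h1 h3⟩
    · rw [hG2 x h3]
      simp only [Complex.add_im, Complex.natCast_im, add_zero]
      exact ⟨hpm _ (by linarith) (by linarith), hqm _ (by linarith) (by linarith)⟩
  have hn2 : (2 : ℝ) ≤ n := by exact_mod_cast hn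
  refine no_family (fun x => G (cs x.1 + cu x.2) - G (cs x.1) - 1) (by fun_prop) ?_ (b - a) p q
    (-1) (n - 1) (by norm_num) (by linarith) ?_ ?_ ?_ ?_
  · rintro ⟨s, u⟩ h0
    dsimp only at h0
    have e1 := hcs1 s
    have e2 := hcs2 s
    have e3 := hcu1 u
    have e4 := hcu2 u
    rw [hG1 _ e2] at h0
    generalize cs s = s at *
    generalize cu u = u at *
    rcases le_total (s + u) b with h3 | h3
    · rw [hG1 _ h3] at h0
      rcases e3.eq_or_lt with h4 | h4
      · rw [← h4] at h0; simp at h0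
      · exact (hno s (s + u) e1 (by linarith) h3).1 (by linear_combination h0)
    · rw [hG2 _ h3] at h0
      have h5 : s + u - (b - a) ≤ s := by linarith
      rcases h5.eq_or_lt with h4 | h4
      · rw [h4] at h0
        have : (n : ℂ) = 1 := by linear_combination h0
        have : n = 1 := by exact_mod_cast this
        omega
      · exact (hno _ s (by linarith) h4 e2).2 (by rw [hn1]; linear_combination -h0)
  · intro s
    simp [hcu3]
  · intro s
    have e1 := hcs1 s
    simp only [hcu4]
    rw [hG1 _ (hcs2 s), hG2 _ (by linarith)]
    simp
  · intro u
    have := (hGim (p + cu u) (by linarith [hp.1, hcu1 u]) (by linarith [hp.2, hcu2 u])).1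
    simp only [hcs3 p hp.1 hp.2, hG1 p hp.2, Complex.sub_im, Complex.one_im]
    linarith
  · intro u
    have := (hGim (q + cu u) (by linarith [hq.1, hcu1 u]) (by linarith [hq.2, hcu2 u])).2
    simp only [hcs3 q hq.1 hq.2, hG1 q hq.2, Complex.sub_im, Complex.one_im]
    linarith

/-- A path with total displacement a positive integer has an ordered chord equal to `1`. -/
lemma chord_one (g : ℝ → ℂ) (hg : Continuous g) (n : ℕ) : ∀ (a b : ℝ), a < b →
    g b - g a = ((n + 1 : ℕ) : ℂ) → ∃ s t, a ≤ s ∧ s < t ∧ t ≤ b ∧ g t - g s = 1 := by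
  induction n with
  | zero => intro a b hab h; exact ⟨a, b, le_rfl, hab, le_rfl, by simpa using h⟩
  | succ k ih =>
    intro a b hab h
    obtain ⟨s, t, h1, h2, h3, h4 | h4⟩ := chord_step g hg a b hab (k + 1 + 1) (by omega) h
    · exact ⟨s, t, h1, h2, h3, h4⟩
    · obtain ⟨s', t', h5, h6, h7, h8⟩ := ih s t h2 h4
      exact ⟨s', t', h1.trans h5, h6, h7.trans h3, h8⟩

/-- A closed curve in `ℝ² ∖ {0}` of degree strictly greater than `1` contains a closed
subcurve of degree `1`: there are parameters `t₁ < t₂` with `γ t₁ = γ t₂` such that the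
restriction of `γ` to `[t₁, t₂]` is a closed curve of degree `1` around `0`. -/
theorem stmt3 (γ : ℝ → ℂ) (n : ℤ)
    (hc : ContinuousOn γ (Icc 0 1)) (hclosed : γ 0 = γ 1)
    (h0 : ∀ t ∈ Icc (0:ℝ) 1, γ t ≠ 0)
    (hdeg : HasDeg γ n) (hn : 1 < n) :
    ∃ t₁ t₂ : ℝ, t₁ ∈ Icc (0:ℝ) 1 ∧ t₂ ∈ Icc (0:ℝ) 1 ∧ t₁ < t₂ ∧
      γ t₁ = γ t₂ ∧ HasDeg (fun s => γ (t₁ + s * (t₂ - t₁))) 1 := by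
  obtain ⟨g, hgc, hexp, hg⟩ := hdeg
  have hI : (2 * Real.pi * Complex.I : ℂ) ≠ 0 := Complex.two_pi_I_ne_zero
  obtain ⟨k, rfl⟩ : ∃ k : ℕ, n = ((k + 1 : ℕ) : ℤ) := ⟨(n - 1).toNat, by omega⟩
  have h01 : (0 : ℝ) ≤ 1 := zero_le_one
  set g' : ℝ → ℂ := fun x => IccExtend h01 (domRestrict (Icc 0 1) g) x / (2 * Real.pi * Complex.I)
    with hg'
  have hval : ∀ x ∈ Icc (0 : ℝ) 1, g' x = g x / (2 * Real.pi * Complex.I) := fun x hx => by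
    simp only [hg', IccExtend_of_mem h01 _ hx, domRestrict_apply]
  have hcont : Continuous g' := (continuousOn_iff_continuous_domRestrict.1 hgc).Icc_extend'.div_const _
  obtain ⟨s, t, h1, h2, h3, h4⟩ := chord_one g' hcont k 0 1 one_pos (by
    rw [hval 0 (by simp), hval 1 (by simp), ← sub_div, hg, div_eq_iff hI]
    push_cast
    ring)
  have hs : s ∈ Icc (0 : ℝ) 1 := ⟨h1, by linarith⟩
  have ht : t ∈ Icc (0 : ℝ) 1 := ⟨by linarith, h3⟩
  rw [hval s hs, hval t ht, ← sub_div, div_eq_iff hI, one_mul] at h4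
  have hmem : ∀ x ∈ Icc (0 : ℝ) 1, s + x * (t - s) ∈ Icc (0 : ℝ) 1 := by
    rintro x ⟨hx0, hx1⟩
    constructor <;> nlinarith
  refine ⟨s, t, hs, ht, h2, ?_, fun x => g (s + x * (t - s)), ?_, ?_, ?_⟩
  · rw [hexp s hs, hexp t ht, sub_eq_iff_eq_add.1 h4, add_comm, Complex.exp_periodic]
  · exact hgc.comp (by fun_prop) hmem
  · intro x hx
    exact hexp _ (hmem x hx)
  · simp only [one_mul, zero_mul, add_zero, add_sub_cancel, h4]
    push_cast
    ring
end

section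
/- Let h be an orientation-preserving homeomorphism of the plane fixing only 0, with module at least 4, and let x ≠ 0. Then there exists a translation arc for h at x: an arc γ from x to h(x) such that γ ∩ h(γ) = {h(x)}. -/
open Set

/-- A loop in `ℝ² ∖ {0}`: a continuous closed curve on `[0,1]` avoiding the origin. -/
def IsLoopIn (γ : ℝ → ℂ) : Prop :=
  ContinuousOn γ (Icc 0 1) ∧ γ 0 = γ 1 ∧ ∀ t ∈ Icc (0:ℝ) 1, γ t ≠ 0

/-- A decomposition of the closed curve `γ` into `l` subarcs, each of which is free for
`h` (disjoint from its image under `h`). The `h`-length of `γ` is the least such `l`. -/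
def Decomp (h : ℂ → ℂ) (γ : ℝ → ℂ) (l : ℕ) : Prop :=
  ∃ t : ℕ → ℝ, t 0 = 0 ∧ t l = 1 ∧ (∀ i < l, t i ≤ t (i + 1)) ∧
    ∀ i < l, ∀ s ∈ Icc (t i) (t (i + 1)), ∀ s' ∈ Icc (t i) (t (i + 1)),
      h (γ s) ≠ γ s'

/-- Orientation preservation, encoded (via Kneser's theorem) as being isotopic to the
identity through bijections of the plane. -/
def IsotopicToId (h : ℂ → ℂ) : Prop :=
  ∃ F : ℝ → ℂ → ℂ, Continuous (Function.uncurry F) ∧ F 0 = id ∧ F 1 = h ∧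
    ∀ t : ℝ, Function.Bijective (F t)

open Complex in
lemma const_of_exp {A : Type*} [TopologicalSpace A] [PreconnectedSpace A] (g : A → ℂ)
    (hg : Continuous g) (he : ∀ a a', exp (g a) = exp (g a')) (a a' : A) : g a = g a' :=
  Complex.isCoveringMap_exp.const_of_comp hg (fun a a' => Subtype.ext (he a a')) a a'

open Complex in
lemma log_diff {A : Type*} [TopologicalSpace A] [PreconnectedSpace A] (g₁ g₂ : A → ℂ) (c : ℂ)
    (h₁ : Continuous g₁) (h₂ : Continuous g₂) (he : ∀ a, exp (g₁ a) = c * exp (g₂ a)) (a a' : A) :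
    g₁ a - g₁ a' = g₂ a - g₂ a' := by
  have := const_of_exp (fun a => g₁ a - g₂ a) (h₁.sub h₂)
    (fun a a' => by simp only [exp_sub, he]; field_simp [exp_ne_zero]) a a'
  linear_combination this

open Complex in
lemma exists_log_s7 {A : Type*} [NormedAddCommGroup A] [NormedSpace ℝ A] (f : A → ℂ)
    (hf : Continuous f) (h0 : ∀ a, f a ≠ 0) (a₀ : A) (e₀ : ℂ) (he : exp e₀ = f a₀) :
    ∃ g : A → ℂ, Continuous g ∧ (∀ a, exp (g a) = f a) ∧ g a₀ = e₀ := by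
  have : SimplyConnectedSpace A := SimplyConnectedSpace.ofContractible A
  obtain ⟨F, ⟨h1, h2⟩, -⟩ := Complex.isCoveringMapOn_exp.existsUnique_continuousMap_lifts
    (⟨f, hf⟩ : C(A, ℂ)) (a₀ := a₀) (e₀ := e₀) he (fun a => h0 a)
  exact ⟨F, F.continuous, fun a => congrFun h2 a, h1⟩

open Complex in
lemma exists_log' {A : Type*} [NormedAddCommGroup A] [NormedSpace ℝ A] (f : A → ℂ)
    (hf : Continuous f) (h0 : ∀ a, f a ≠ 0) :
    ∃ g : A → ℂ, Continuous g ∧ (∀ a, exp (g a) = f a) := by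
  obtain ⟨g, h1, h2, -⟩ := exists_log_s7 f hf h0 0 (Complex.log (f 0)) (Complex.exp_log (h0 0))
  exact ⟨g, h1, h2⟩

/-- Franks-type lemma: a fixed point free map isotopic to the identity has no free path
`β` with `H (H (β 0)) = β 1`. -/
lemma franks (F : ℝ → ℂ → ℂ) (Fc : Continuous (Function.uncurry F)) (F0 : ∀ w, F 0 w = w)
    (Finj : ∀ s, Function.Injective (F s)) (hfp : ∀ w, F 1 w ≠ w)
    (β : ℝ → ℂ) (hβ : Continuous β) (hfree : ∀ u v, F 1 (β u) ≠ β v) :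
    F 1 (F 1 (β 0)) ≠ β 1 := by
  intro hq
  have Fc' : ∀ {X : Type} [TopologicalSpace X] (a : X → ℝ) (b : X → ℂ), Continuous a →
      Continuous b → Continuous (fun y => F (a y) (b y)) :=
    fun a b ha hb => Fc.comp (ha.prodMk hb)
  have Hc : Continuous (F 1) := Fc' (fun _ => 1) id continuous_const continuous_id
  set H := F 1 with hH
  obtain ⟨L, Lc, hL⟩ := exists_log' (fun w : ℂ => H w - w) (by fun_prop)
    (fun w => sub_ne_zero.2 (hfp w))
  obtain ⟨K, Kc, hK⟩ := exists_log' (fun y : ℝ × ℂ => F y.1 (H y.2) - F y.1 y.2)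
    ((Fc' _ _ (by fun_prop) (by fun_prop)).sub (Fc' _ _ (by fun_prop) (by fun_prop)))
    (fun y => sub_ne_zero.2 (fun h => hfp _ (Finj _ h)))
  obtain ⟨S, Sc, hS⟩ := exists_log' (fun y : ℝ × ℝ => H (β y.2) - β y.1) (by fun_prop)
    (fun y => sub_ne_zero.2 (hfree _ _))
  obtain ⟨R, Rc, hR⟩ := exists_log' (fun y : ℝ × ℝ => F y.1 (β y.2) - F y.1 (H (β 0)))
    ((Fc' _ _ (by fun_prop) (by fun_prop)).sub (Fc' _ _ (by fun_prop) (by fun_prop)))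
    (fun y => sub_ne_zero.2 (fun h => hfree _ _ (Finj _ h).symm))
  -- relations
  have e1 : ∀ w w', K (0, w) - K (0, w') = L w - L w' := fun w w' =>
    log_diff (fun w => K (0, w)) L 1 (by fun_prop) Lc (fun w => by simp [hK, hL, F0]) w w'
  have e2 : ∀ w w', K (1, w) - K (1, w') = L (H w) - L (H w') := fun w w' =>
    log_diff (fun w => K (1, w)) (fun w => L (H w)) 1 (by fun_prop) (by fun_prop)
      (fun w => by simp [hK, hL, hH]) w w'
  have e3 : R (0, 1) - R (0, 0) = S (1, 0) - S (0, 0) :=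
    log_diff (fun u => R (0, u)) (fun u => S (u, 0)) (-1) (by fun_prop) (by fun_prop)
      (fun w => by simp [hR, hS, F0]) 1 0
  have e4 : R (1, 1) - R (1, 0) = S (1, 1) - S (1, 0) :=
    log_diff (fun u => R (1, u)) (fun u => S (1, u)) 1 (by fun_prop) (by fun_prop)
      (fun w => by simp [hR, hS, ← hH, hq]) 1 0
  have e5 : R (0, 1) - R (1, 1) = K (0, H (β 0)) - K (1, H (β 0)) :=
    log_diff (fun s => R (s, 1)) (fun s => K (s, H (β 0))) 1 (by fun_prop) (by fun_prop)
      (fun w => by simp [hR, hK, hq]) 0 1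
  have e6 : R (0, 0) - R (1, 0) = K (0, β 0) - K (1, β 0) :=
    log_diff (fun s => R (s, 0)) (fun s => K (s, β 0)) (-1) (by fun_prop) (by fun_prop)
      (fun w => by simp [hR, hK]) 0 1
  have e7 : S (1, 1) - S (0, 0) = L (β 1) - L (β 0) :=
    log_diff (fun s => S (s, s)) (fun s => L (β s)) 1 (by fun_prop) (by fun_prop)
      (fun w => by simp [hS, hL]) 1 0
  have a1 := e1 (H (β 0)) (β 0)
  have a2 := e2 (H (β 0)) (β 0)
  rw [hq] at a2
  -- kk = R(0,0) - K(0, β 0) - (R (0,1) - K (0, H β0)) has exp = -1 and twice it is 0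
  have b1 : (R (0, 0) - K (0, β 0)) - (R (0, 1) - K (0, H (β 0))) = 0 := by
    linear_combination (1/2) * (-e3 - e4 - e5 + e6 - e7 + a1 + a2)
  have b2 := congrArg Complex.exp b1
  rw [Complex.exp_sub, Complex.exp_sub, Complex.exp_sub, hR, hR, hK, hK] at b2
  simp only [F0, hq] at b2
  have n1 : H (β 0) - β 0 ≠ 0 := sub_ne_zero.2 (hfp _)
  have n2 : β 1 - H (β 0) ≠ 0 := sub_ne_zero.2 (fun h => hfree _ _ h.symm)
  rw [div_self n2, div_one, ← neg_sub, neg_div, div_self n1, Complex.exp_zero] at b2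
  norm_num at b2

lemma mem_slit_of_re_nonneg {z : ℂ} (h : 0 ≤ z.re) (h0 : z ≠ 0) : z ∈ Complex.slitPlane := by
  rw [Complex.mem_slitPlane_iff]
  by_contra hc
  push Not at hc
  exact h0 (Complex.ext (by simp; linarith [hc.1]) (by simp [hc.2]))

lemma half_plane (c : ℂ) (hc : c ≠ 0) (g : ℝ → ℂ) (hg : Continuous g)
    (hre : ∀ t, 0 ≤ (c * Complex.exp (g t)).re) (t t' : ℝ) :
    g t - g t' = Complex.log (c * Complex.exp (g t)) - Complex.log (c * Complex.exp (g t')) := by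
  have hn : ∀ t, c * Complex.exp (g t) ≠ 0 := fun t => mul_ne_zero hc (Complex.exp_ne_zero _)
  refine log_diff g (fun t => Complex.log (c * Complex.exp (g t))) c⁻¹ hg ?_ ?_ t t'
  · exact Continuous.clog (by fun_prop) (fun t => mem_slit_of_re_nonneg (hre t) (hn t))
  · intro a
    rw [Complex.exp_log (hn a)]
    field_simp

open Complex in
/-- A simple loop has degree at most one. -/
lemma simple_loop (f : ℝ → ℂ) (hf : Continuous f)
    (hinj : ∀ s ∈ Icc (0:ℝ) 1, ∀ t ∈ Icc (0:ℝ) 1, exp (f s) = exp (f t) →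
      s = t ∨ (s = 0 ∧ t = 1) ∨ (s = 1 ∧ t = 0))
    (d : ℤ) (hd : 2 ≤ d) (h1 : f 1 = f 0 + d * (2 * Real.pi * I)) : False := by
  have hpi : (2 * Real.pi * I : ℂ) ≠ 0 := by
    simp [Real.pi_ne_zero]
  -- clamp
  set cl : ℝ → ℝ := fun t => max 0 (min 1 t) with hcl
  have clc : Continuous cl := by fun_prop
  have clm : ∀ t, cl t ∈ Icc (0:ℝ) 1 := fun t => ⟨le_max_left _ _, by simp [hcl]⟩
  have cle : ∀ t ∈ Icc (0:ℝ) 1, cl t = t := fun t ht => by simp [hcl, ht.1, ht.2]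
  set e : ℝ → ℂ := fun t => f (cl t) with he
  have ec : Continuous e := hf.comp clc
  have e0 : e 0 = f 0 := by simp [he, hcl]
  have e1 : e 1 = f 0 + d * (2 * Real.pi * I) := by simp [he, hcl, h1]
  have key : ∀ (k : ℤ), k ≠ 0 → k ≠ d → k ≠ -d → ∀ s t, e t - e s ≠ k * (2 * Real.pi * I) := by
    intro k k0 k1 k2 s t h
    have hh : exp (f (cl t)) = exp (f (cl s)) :=
      exp_eq_exp_iff_exists_int.2 ⟨k, by linear_combination h⟩
    have : ∀ m : ℤ, e t - e s = m * (2 * Real.pi * I) → k = m := by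
      intro m hm
      rw [h] at hm
      exact_mod_cast mul_right_cancel₀ hpi hm
    rcases hinj _ (clm t) _ (clm s) hh with h' | ⟨h', h''⟩ | ⟨h', h''⟩
    · exact k0 (this 0 (by simp [he, h']))
    · refine k2 (this _ ?_)
      simp only [he, h', h'', h1]; push_cast; ring
    · refine k1 (this _ ?_)
      simp only [he, h', h'', h1]; ring
  obtain ⟨A, Ac, hA⟩ := exists_log' (fun y : ℝ × ℝ => e y.2 - e y.1 - 2 * Real.pi * I)
    (by fun_prop) (fun y => sub_ne_zero.2 (by
      have := key 1 (by norm_num) (by omega) (by omega) y.1 y.2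
      simpa using this))
  obtain ⟨B, Bc, hB⟩ := exists_log' (fun y : ℝ × ℝ => e y.2 - e y.1 + (d - 1) * (2 * Real.pi * I))
    (by fun_prop) (fun y => by
      have := key (-(d-1)) (by omega) (by omega) (by omega) y.1 y.2
      intro h
      apply this
      push_cast
      linear_combination h)
  have cAB : ∀ s s', A (s, 1) - A (s', 1) = B (s, 0) - B (s', 0) := fun s s' =>
    log_diff (fun s => A (s, 1)) (fun s => B (s, 0)) 1 (by fun_prop) (by fun_prop)
      (fun s => by rw [hA, hB]; simp only [e0, e1]; ring) s s'
  have cA : ∀ s s', A (s, s) = A (s', s') := fun s s' =>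
    const_of_exp (fun s => A (s, s)) (by fun_prop) (fun s s' => by simp [hA]) s s'
  have cB : ∀ s s', B (s, s) = B (s', s') := fun s s' =>
    const_of_exp (fun s => B (s, s)) (by fun_prop) (fun s s' => by simp [hB]) s s'
  set V : ℝ → ℂ := fun s => (B (s, s) - B (s, 0)) + (A (s, 1) - A (s, s)) with hV
  have hVc : ∀ s s', V s = V s' := fun s s' => by
    simp only [hV]
    linear_combination cAB s s' - cA s s' + cB s s'
  obtain ⟨σ, hσ, hσm⟩ := isCompact_Icc.exists_isMinOn (nonempty_Icc.2 (zero_le_one' ℝ))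
    (f := fun t => (e t).re) (by fun_prop)
  obtain ⟨τ, hτ, hτm⟩ := isCompact_Icc.exists_isMaxOn (nonempty_Icc.2 (zero_le_one' ℝ))
    (f := fun t => (e t).re) (by fun_prop)
  have ecl : ∀ t, e (cl t) = e t := fun t => by simp only [he]; rw [cle _ (clm t)]
  have hσ' : ∀ t, (e σ).re ≤ (e t).re := fun t => by
    have : (e σ).re ≤ (e (cl t)).re := hσm (clm t)
    rwa [ecl] at this
  have hτ' : ∀ t, (e t).re ≤ (e τ).re := fun t => by
    have : (e (cl t)).re ≤ (e τ).re := hτm (clm t)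
    rwa [ecl] at this
  have hVe : ∀ (c : ℝ), c ≠ 0 → ∀ s, (∀ t, 0 ≤ c * ((e t).re - (e s).re)) →
      V s = log (c * ((d - 1) * (2 * Real.pi * I))) - log (c * (- (2 * Real.pi * I))) := by
    intro c hc s hs
    have q1 := half_plane c (by exact_mod_cast hc) (fun t => B (s, t)) (by fun_prop)
      (fun t => by simpa [hB] using hs t) s 0
    have q2 := half_plane c (by exact_mod_cast hc) (fun t => A (s, t)) (by fun_prop)
      (fun t => by simpa [hA] using hs t) 1 s
    simp only [hA, hB, e0, e1, sub_self, zero_add] at q1 q2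
    simp only [hV]
    rw [q1, q2]
    ring_nf
  have v1 := hVe 1 one_ne_zero σ (fun t => by linarith [hσ' t])
  have v2 := hVe (-1) (by norm_num) τ (fun t => by linarith [hτ' t])
  have v3 := hVc σ τ
  rw [v1, v2] at v3
  have hdp : (0:ℝ) < (d - 1) * (2 * Real.pi) := by
    have : (2:ℝ) ≤ d := by exact_mod_cast hd
    have := Real.pi_pos
    apply mul_pos <;> linarith
  have hp2 : (0:ℝ) < 2 * Real.pi := by positivity
  have w1 : ((1:ℝ):ℂ) * ((d - 1) * (2 * Real.pi * I)) = ((((d:ℝ) - 1) * (2 * Real.pi) : ℝ) : ℂ) * I := by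
    push_cast; ring
  have w2 : ((1:ℝ):ℂ) * (- (2 * Real.pi * I)) = ((2 * Real.pi : ℝ) : ℂ) * (-I) := by
    push_cast; ring
  have w3 : ((-1:ℝ):ℂ) * ((d - 1) * (2 * Real.pi * I)) = ((((d:ℝ) - 1) * (2 * Real.pi) : ℝ) : ℂ) * (-I) := by
    push_cast; ring
  have w4 : ((-1:ℝ):ℂ) * (- (2 * Real.pi * I)) = ((2 * Real.pi : ℝ) : ℂ) * I := by
    push_cast; ring
  rw [w1, w2, w3, w4] at v3
  have v4 := congrArg Complex.im v3
  simp only [Complex.sub_im, Complex.log_im, Complex.arg_real_mul _ hdp, Complex.arg_real_mul _ hp2,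
    Complex.arg_I, Complex.arg_neg_I] at v4
  linarith [Real.pi_pos]

open Complex in
lemma core_pos (h : ℂ → ℂ)
    (hmod : ∀ γ : ℝ → ℂ, IsLoopIn γ → HasDeg γ 1 → ∀ l : ℕ, Decomp h γ l → 4 ≤ l)
    (f : ℝ → ℂ) (hf : Continuous f)
    (hinj : ∀ s ∈ Icc (0:ℝ) 1, ∀ t ∈ Icc (0:ℝ) 1, exp (f s) = exp (f t) →
      s = t ∨ (s = 0 ∧ t = 1) ∨ (s = 1 ∧ t = 0))
    (d : ℤ) (hd : 1 ≤ d) (h1 : f 1 = f 0 + d * (2 * Real.pi * I))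
    (p q : ℝ) (hp : 0 ≤ p) (hpq : p ≤ q) (hq : q ≤ 1)
    (free1 : ∀ s ∈ Icc 0 p, ∀ t ∈ Icc 0 p, h (exp (f s)) ≠ exp (f t))
    (free2 : ∀ s ∈ Icc p q, ∀ t ∈ Icc p q, h (exp (f s)) ≠ exp (f t))
    (free3 : ∀ s ∈ Icc q 1, ∀ t ∈ Icc q 1, h (exp (f s)) ≠ exp (f t)) : False := by
  rcases hd.eq_or_lt with rfl | hd
  · have := hmod (fun t => exp (f t)) ⟨by fun_prop, ?_, fun t _ => exp_ne_zero _⟩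
      ⟨f, by fun_prop, fun _ _ => rfl, by rw [h1]; push_cast; ring⟩ 3
      ⟨fun i => if i = 0 then 0 else if i = 1 then p else if i = 2 then q else 1,
        by simp, by simp, ?_, ?_⟩
    · omega
    · rw [exp_eq_exp_iff_exists_int]
      exact ⟨-1, by rw [h1]; push_cast; ring⟩
    · intro i hi
      interval_cases i <;> simpa
    · intro i hi
      interval_cases i
      · simpa using free1
      · simpa using free2
      · simpa using free3
  · exact simple_loop f hf hinj d hd h1

open Complex in
lemma core (h : ℂ → ℂ)
    (hmod : ∀ γ : ℝ → ℂ, IsLoopIn γ → HasDeg γ 1 → ∀ l : ℕ, Decomp h γ l → 4 ≤ l)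
    (Γ : ℝ → ℂ) (hΓ : Continuous Γ) (a p q c : ℝ) (hac : a < c)
    (hinj : ∀ s ∈ Icc a c, ∀ t ∈ Icc a c, exp (Γ s) = exp (Γ t) →
      s = t ∨ (s = a ∧ t = c) ∨ (s = c ∧ t = a))
    (hcl : exp (Γ c) = exp (Γ a)) (hne : Γ c ≠ Γ a)
    (hp : a ≤ p) (hpq : p ≤ q) (hq : q ≤ c)
    (free1 : ∀ s ∈ Icc a p, ∀ t ∈ Icc a p, h (exp (Γ s)) ≠ exp (Γ t))
    (free2 : ∀ s ∈ Icc p q, ∀ t ∈ Icc p q, h (exp (Γ s)) ≠ exp (Γ t))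
    (free3 : ∀ s ∈ Icc q c, ∀ t ∈ Icc q c, h (exp (Γ s)) ≠ exp (Γ t)) : False := by
  obtain ⟨d, hd⟩ := exp_eq_exp_iff_exists_int.1 hcl
  have hd0 : d ≠ 0 := by
    rintro rfl
    exact hne (by simpa using hd)
  have hl : 0 < c - a := sub_pos.2 hac
  have hl' : c - a ≠ 0 := hl.ne'
  rcases lt_or_gt_of_ne hd0 with hneg | hpos
  · refine core_pos h hmod (fun t => Γ (c - t * (c - a))) (by fun_prop) ?_ (-d) (by omega) ?_
      ((c - q) / (c - a)) ((c - p) / (c - a)) (by apply div_nonneg <;> linarith) (by gcongr)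
      (by rw [div_le_one hl]; linarith) ?_ ?_ ?_
    · intro s hs t ht hst
      have := hinj _ ⟨by nlinarith [hs.1, hs.2], by nlinarith [hs.1, hs.2]⟩ _
        ⟨by nlinarith [ht.1, ht.2], by nlinarith [ht.1, ht.2]⟩ hst
      rcases this with h' | ⟨h', h''⟩ | ⟨h', h''⟩
      · left; exact mul_right_cancel₀ hl' (by linarith)
      · right; right
        exact ⟨mul_right_cancel₀ hl' (by linarith), mul_right_cancel₀ hl' (by linarith)⟩
      · right; left
        exact ⟨mul_right_cancel₀ hl' (by linarith), mul_right_cancel₀ hl' (by linarith)⟩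
    · simp only [one_mul, zero_mul, sub_zero, sub_sub_cancel]
      push_cast
      linear_combination -hd
    · intro s hs t ht
      rw [mem_Icc, le_div_iff₀ hl] at hs ht
      exact free3 _ ⟨by linarith, by nlinarith⟩ _ ⟨by linarith, by nlinarith⟩
    · intro s hs t ht
      rw [mem_Icc, le_div_iff₀ hl, div_le_iff₀ hl] at hs ht
      exact free2 _ ⟨by linarith, by linarith⟩ _ ⟨by linarith, by linarith⟩
    · intro s hs t ht
      rw [mem_Icc, div_le_iff₀ hl] at hs ht
      exact free1 _ ⟨by nlinarith, by linarith⟩ _ ⟨by nlinarith, by linarith⟩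
  · refine core_pos h hmod (fun t => Γ (a + t * (c - a))) (by fun_prop) ?_ d (by omega) ?_
      ((p - a) / (c - a)) ((q - a) / (c - a)) (by apply div_nonneg <;> linarith) (by gcongr)
      (by rw [div_le_one hl]; linarith) ?_ ?_ ?_
    · intro s hs t ht hst
      have := hinj _ ⟨by nlinarith [hs.1, hs.2], by nlinarith [hs.1, hs.2]⟩ _
        ⟨by nlinarith [ht.1, ht.2], by nlinarith [ht.1, ht.2]⟩ hst
      rcases this with h' | ⟨h', h''⟩ | ⟨h', h''⟩
      · left; exact mul_right_cancel₀ hl' (by linarith)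
      · right; left
        exact ⟨mul_right_cancel₀ hl' (by linarith), mul_right_cancel₀ hl' (by linarith)⟩
      · right; right
        exact ⟨mul_right_cancel₀ hl' (by linarith), mul_right_cancel₀ hl' (by linarith)⟩
    · simp only [one_mul, zero_mul, add_zero, add_sub_cancel]
      exact hd
    · intro s hs t ht
      rw [mem_Icc, le_div_iff₀ hl] at hs ht
      exact free1 _ ⟨by nlinarith, by linarith⟩ _ ⟨by nlinarith, by linarith⟩
    · intro s hs t ht
      rw [mem_Icc, le_div_iff₀ hl, div_le_iff₀ hl] at hs ht
      exact free2 _ ⟨by linarith, by linarith⟩ _ ⟨by linarith, by linarith⟩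
    · intro s hs t ht
      rw [mem_Icc, div_le_iff₀ hl] at hs ht
      exact free3 _ ⟨by linarith, by nlinarith⟩ _ ⟨by linarith, by nlinarith⟩

open Complex in
lemma lift_isotopy (h : ℂ → ℂ) (hor : IsotopicToId h) (h0 : h 0 = 0) (z z' : ℂ)
    (hz : h (exp z) = exp z') :
    ∃ F : ℝ → ℂ → ℂ, Continuous (Function.uncurry F) ∧ (∀ w, F 0 w = w) ∧
      (∀ s, Function.Injective (F s)) ∧ (∀ w, exp (F 1 w) = h (exp w)) ∧ F 1 z = z' := by
  obtain ⟨G, Gc, G0, G1, Gb⟩ := hor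
  have Gc' : ∀ {X : Type} [TopologicalSpace X] (a : X → ℝ) (b : X → ℂ), Continuous a →
      Continuous b → Continuous (fun y => G (a y) (b y)) :=
    fun a b ha hb => Gc.comp (ha.prodMk hb)
  obtain ⟨K, Kc, hK, K0⟩ := exists_log_s7 (fun y : ℝ × ℂ => G y.1 (exp y.2) - G y.1 0)
    ((Gc' _ _ (by fun_prop) (by fun_prop)).sub (Gc' _ _ (by fun_prop) (by fun_prop)))
    (fun y => sub_ne_zero.2 (fun h => exp_ne_zero _ ((Gb _).1 h))) (0, 0) 0
    (by simp [G0])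
  have Kid : ∀ w, K (0, w) = w := by
    intro w
    have := log_diff (fun w => K (0, w)) id 1 (by fun_prop) continuous_id
      (fun w => by simp [hK, G0]) w 0
    simpa [K0] using this
  have Kper : ∀ s w (n : ℤ), K (s, w + n * (2 * Real.pi * I)) - K (s, w) =
      n * (2 * Real.pi * I) := by
    intro s w n
    have := const_of_exp (fun s => K (s, w + n * (2 * Real.pi * I)) - K (s, w)) (by fun_prop)
      (fun s s' => by
        have : exp (w + n * (2 * Real.pi * I)) = exp w := exp_eq_exp_iff_exists_int.2 ⟨n, rfl⟩
        simp only [exp_sub, hK, this]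
        rw [div_self, div_self] <;>
        exact sub_ne_zero.2 (fun h => exp_ne_zero _ ((Gb _).1 h))) s 0
    simp only [Kid] at this
    rw [this]; ring
  have hz2 : exp z' = exp (K (1, z)) := by
    rw [hK, ← hz]; simp [G1, h0]
  obtain ⟨n, hn⟩ := exp_eq_exp_iff_exists_int.1 hz2
  refine ⟨fun s w => K (s, w) + s * (n * (2 * Real.pi * I)), ?_, ?_, ?_, ?_, ?_⟩
  · simp only [Function.uncurry_def]; fun_prop
  · intro w; simp [Kid]
  · intro s w w' hw
    have hw1 : K (s, w) = K (s, w') := by simpa using hw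
    have hw2 := congrArg exp hw1
    rw [hK, hK] at hw2
    have hw3 := (Gb s).1 (sub_left_injective hw2)
    obtain ⟨m, hm⟩ := exp_eq_exp_iff_exists_int.1 hw3
    have := Kper s w' m
    rw [← hm, hw1, sub_self] at this
    change w = w' + _ at hm
    rw [hm, ← this, add_zero]
  · intro w
    have : exp (K (1, w) + ((1:ℝ):ℂ) * (n * (2 * Real.pi * I))) = exp (K (1, w)) :=
      exp_eq_exp_iff_exists_int.2 ⟨n, by simp⟩
    rw [this, hK]; simp [G1, h0]
  · simp [hn]

set_option maxHeartbeats 2000000 in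
open Complex in
lemma main_curve (h : ℂ → ℂ) (hhinj : Function.Injective h)
    (hmod : ∀ γ : ℝ → ℂ, IsLoopIn γ → HasDeg γ 1 → ∀ l : ℕ, Decomp h γ l → 4 ≤ l)
    (hfx : ∀ y, y ≠ 0 → h y ≠ y)
    (F : ℝ → ℂ → ℂ) (Fc : Continuous (Function.uncurry F)) (F0 : ∀ w, F 0 w = w)
    (Finj : ∀ s, Function.Injective (F s)) (F1 : ∀ w, exp (F 1 w) = h (exp w))
    (Γ : ℝ → ℂ) (hΓ : Continuous Γ) (hΓ1 : ∀ t ∈ Icc (0:ℝ) 2, Γ (t + 1) = F 1 (Γ t))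
    (inj : ∀ s ∈ Icc (0:ℝ) 1, ∀ t ∈ Icc (0:ℝ) 1, exp (Γ s) = exp (Γ t) → s = t)
    (tr0 : ∀ s ∈ Icc (0:ℝ) 1, ∀ t ∈ Icc (0:ℝ) 1, exp (Γ s) = h (exp (Γ t)) →
      (s = 1 ∧ t = 0) ∨ (s = 0 ∧ t = 1)) :
    ∃ γ : ℝ → ℂ, ContinuousOn γ (Icc 0 1) ∧ InjOn γ (Icc 0 1) ∧
      γ 0 = exp (Γ (1/2)) ∧ γ 1 = h (exp (Γ (1/2))) ∧
      (γ '' Icc (0:ℝ) 1) ∩ ((h ∘ γ) '' Icc (0:ℝ) 1) = {h (exp (Γ (1/2)))} := by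
  have hfp : ∀ w, F 1 w ≠ w := fun w hw => hfx _ (exp_ne_zero w) (by rw [← F1, hw])
  have hs : ∀ t, 0 ≤ t → t ≤ 2 → exp (Γ (t + 1)) = h (exp (Γ t)) := fun t h1 h2 => by
    rw [hΓ1 t ⟨h1, h2⟩, F1]
  -- shifted forms
  have hs1 : ∀ t, 1 ≤ t → t ≤ 3 → exp (Γ t) = h (exp (Γ (t - 1))) := fun t h1 h2 => by
    rw [← hs (t - 1) (by linarith) (by linarith), sub_add_cancel]
  have down : ∀ s t, 1 ≤ s → s ≤ 3 → 1 ≤ t → t ≤ 3 → exp (Γ s) = exp (Γ t) →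
      exp (Γ (s - 1)) = exp (Γ (t - 1)) := fun s t h1 h2 h3 h4 e => by
    rw [hs1 s h1 h2, hs1 t h3 h4] at e
    exact hhinj e
  have hc : Continuous fun t => exp (Γ t) := by fun_prop
  -- no period two
  have hper : exp (Γ 2) ≠ exp (Γ 0) := by
    intro h20
    have hcl : IsClosed ((fun t => exp (Γ t)) '' Icc 2 (5/2)) :=
      (isCompact_Icc.image hc).isClosed
    have hop : IsOpen ((fun t => exp (Γ t)) ⁻¹' ((fun t => exp (Γ t)) '' Icc 2 (5/2))ᶜ) :=
      hcl.isOpen_compl.preimage hc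
    obtain ⟨δ, hδ, hball⟩ := Metric.isOpen_iff.1 hop 1 (by
      rintro ⟨u, hu, hu'⟩
      simp only at hu'
      have e1 := down _ _ (by linarith [hu.1]) (by linarith [hu.2]) le_rfl (by norm_num) hu'
      rw [hs1 (u - 1) (by linarith [hu.1]) (by linarith [hu.2])] at e1
      rcases tr0 _ ⟨by norm_num, by norm_num⟩ _ ⟨by linarith [hu.1], by linarith [hu.2]⟩ e1.symm
        with h' | h'
      · norm_num at h'
      · linarith [hu.2, h'.2])
    obtain ⟨ε, hε0, hε1, hε2⟩ : ∃ ε : ℝ, 0 < ε ∧ ε < δ ∧ ε ≤ 1/4 :=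
      ⟨min (δ / 2) (1/4), by positivity, by
        have := min_le_left (δ / 2) (1/4); linarith, min_le_right _ _⟩
    refine core h hmod Γ hΓ 0 (1 - ε) (3/2) 2 (by norm_num) ?_ h20 ?_ (by linarith) (by linarith)
      (by norm_num) ?_ ?_ ?_
    · have key : ∀ s t, 0 ≤ s → s ≤ t → t ≤ 2 → exp (Γ s) = exp (Γ t) → s = t ∨ (s = 0 ∧ t = 2) := by
        intro s t h1 h2 h3 e
        rcases le_total t 1 with ht | ht
        · exact Or.inl (inj _ ⟨h1, by linarith⟩ _ ⟨by linarith, ht⟩ e)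
        rcases le_total s 1 with hs' | hs'
        · rw [hs1 t ht (by linarith)] at e
          rcases tr0 _ ⟨h1, hs'⟩ _ ⟨by linarith, by linarith⟩ e with h' | h'
          · left; linarith [h'.1, h'.2]
          · right; exact ⟨h'.1, by linarith [h'.2]⟩
        · have := inj _ ⟨by linarith, by linarith⟩ _ ⟨by linarith, by linarith⟩
            (down s t hs' (by linarith) ht (by linarith) e)
          left; linarith
      intro s hs t ht e
      rcases le_total s t with hst | hst
      · rcases key s t hs.1 hst ht.2 e with h' | h'
        · exact Or.inl h'
        · exact Or.inr (Or.inl h')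
      · rcases key t s ht.1 hst hs.2 e.symm with h' | h'
        · exact Or.inl h'.symm
        · exact Or.inr (Or.inr h'.symm)
    · have := franks F Fc F0 Finj hfp (fun _ => Γ 0) continuous_const (fun _ _ => hfp _)
      intro h'
      apply this
      rw [← hΓ1 0 (by norm_num), ← hΓ1 (0 + 1) (by norm_num), ← h']
      norm_num
    · intro s hs t ht e
      rcases tr0 t ⟨ht.1, by linarith [ht.2]⟩ s ⟨hs.1, by linarith [hs.2]⟩ e.symm with h' | h'
      · linarith [h'.1, ht.2]
      · linarith [h'.2, hs.2]
    · intro s ⟨hsl, hsr⟩ t ⟨htl, htr⟩ e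
      rcases le_total t 1 with ht | ht <;> rcases le_total s 1 with hs' | hs'
      · rcases tr0 t ⟨by linarith, ht⟩ s ⟨by linarith, hs'⟩ e.symm with h' | h'
        · linarith [h'.2]
        · linarith [h'.1]
      · have : t ∈ Metric.ball (1:ℝ) δ := by
          rw [Metric.mem_ball, Real.dist_eq, abs_lt]; constructor <;> linarith
        refine hball this ⟨s + 1, ⟨by linarith, by linarith⟩, ?_⟩
        simp only
        rw [hs s (by linarith) (by linarith), e]
      · rw [hs1 t ht (by linarith)] at e
        have := inj _ ⟨by linarith, hs'⟩ _ ⟨by linarith, by linarith⟩ (hhinj e)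
        linarith
      · rw [hs1 t ht (by linarith)] at e
        have e := hhinj e
        rw [hs1 s hs' (by linarith)] at e
        rcases tr0 _ ⟨by linarith, by linarith⟩ _ ⟨by linarith, by linarith⟩ e.symm with h' | h'
        · linarith [h'.1]
        · linarith [h'.2]
    · intro s ⟨hsl, hsr⟩ t ⟨htl, htr⟩ e
      rw [hs1 t (by linarith) (by linarith)] at e
      have e := hhinj e
      rw [hs1 s (by linarith) (by linarith)] at e
      rcases tr0 _ ⟨by linarith, by linarith⟩ _ ⟨by linarith, by linarith⟩ e.symm with h' | h'
      · linarith [h'.2]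
      · linarith [h'.1]
  have tr : ∀ s, 0 ≤ s → s ≤ 1 → ∀ t, 0 ≤ t → t ≤ 1 → exp (Γ s) = h (exp (Γ t)) →
      s = 1 ∧ t = 0 := by
    intro s h1 h2 t h3 h4 e
    rcases tr0 s ⟨h1, h2⟩ t ⟨h3, h4⟩ e with h' | ⟨rfl, rfl⟩
    · exact h'
    · exfalso
      apply hper
      rw [hs1 2 (by norm_num) (by norm_num), e]
      norm_num
  -- no bad pair
  have hbad : ∀ a, 1/2 ≤ a → a ≤ 1 → ∀ b, 0 ≤ b → b ≤ 1/2 → exp (Γ a) ≠ exp (Γ (2 + b)) := by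
    intro a₁ ha₁ ha₁' b₁ hb₁ hb₁' e₁
    have hcl : IsClosed ((fun t => exp (Γ t)) '' Icc (1/2) 1) :=
      (isCompact_Icc.image hc).isClosed
    have hcomp : IsCompact (Icc (0:ℝ) (1/2) ∩
        ((fun b => exp (Γ (2 + b))) ⁻¹' ((fun t => exp (Γ t)) '' Icc (1/2) 1))) :=
      isCompact_Icc.inter_right (hcl.preimage (by fun_prop))
    obtain ⟨b, ⟨⟨hb0, hb1⟩, a, ⟨ha0, ha1⟩, hab⟩, hmin⟩ := hcomp.exists_isLeast
      ⟨b₁, ⟨hb₁, hb₁'⟩, a₁, ⟨ha₁, ha₁'⟩, e₁⟩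
    simp only at hab
    have hmin' : ∀ t, 1/2 ≤ t → t ≤ 1 → ∀ u, 0 ≤ u → u ≤ b → exp (Γ t) = exp (Γ (2 + u)) →
        u = b ∧ t = a := by
      intro t h1 h2 u h3 h4 e
      have hub : u = b := le_antisymm h4 (hmin ⟨⟨h3, by linarith⟩, t, ⟨h1, h2⟩, e⟩)
      refine ⟨hub, inj _ ⟨by linarith, h2⟩ _ ⟨by linarith, ha1⟩ ?_⟩
      rw [hab, e, hub]
    have haltb : a < 1 := by
      refine lt_of_le_of_ne ha1 ?_
      rintro rfl
      have e := down _ _ le_rfl (by norm_num) (by linarith) (by linarith) hab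
      rw [hs1 (2 + b - 1) (by linarith) (by linarith)] at e
      have := tr _ (by norm_num) (by norm_num) _ (by linarith) (by linarith) e
      norm_num at this
    refine core h hmod Γ hΓ a 1 (1 + (a + 1) / 2) (2 + b) (by linarith) ?_ hab.symm ?_ ha1
      (by linarith) (by linarith) ?_ ?_ ?_
    · have key : ∀ s t, a ≤ s → s ≤ t → t ≤ 2 + b → exp (Γ s) = exp (Γ t) →
          s = t ∨ (s = a ∧ t = 2 + b) := by
        intro s t h1 h2 h3 e
        rcases le_total t 1 with ht | ht
        · exact Or.inl (inj _ ⟨by linarith, by linarith⟩ _ ⟨by linarith, ht⟩ e)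
        rcases le_total s 1 with hs' | hs'
        · rcases le_total t 2 with ht' | ht'
          · rw [hs1 t ht (by linarith)] at e
            have := tr _ (by linarith) hs' _ (by linarith) (by linarith) e
            left; linarith [this.1, this.2]
          · have := hmin' s (by linarith) hs' (t - 2) (by linarith) (by linarith)
              (by rw [e, add_sub_cancel])
            right; exact ⟨this.2, by linarith [this.1]⟩
        · have e := down s t hs' (by linarith) ht (by linarith) e
          rcases le_total t 2 with ht' | ht'
          · have := inj _ ⟨by linarith, by linarith⟩ _ ⟨by linarith, by linarith⟩ e
            left; linarith
          rcases le_total s 2 with hs2 | hs2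
          · rw [hs1 (t - 1) (by linarith) (by linarith)] at e
            have := tr _ (by linarith) (by linarith) _ (by linarith) (by linarith) e
            left; linarith [this.1, this.2]
          · have e := down _ _ (by linarith) (by linarith) (by linarith) (by linarith) e
            have := inj _ ⟨by linarith, by linarith⟩ _ ⟨by linarith, by linarith⟩ e
            left; linarith
      intro s hs t ht e
      rcases le_total s t with hst | hst
      · rcases key s t hs.1 hst ht.2 e with h' | h'
        · exact Or.inl h'
        · exact Or.inr (Or.inl h')
      · rcases key t s ht.1 hst hs.2 e.symm with h' | h'
        · exact Or.inl h'.symm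
        · exact Or.inr (Or.inr h'.symm)
    · set cl : ℝ → ℝ := fun t => max b (min a (b + (a - b) * t)) with hcl'
      have clm : ∀ t, b ≤ cl t ∧ cl t ≤ a :=
        fun t => ⟨le_max_left _ _, max_le (by linarith) (min_le_left _ _)⟩
      have := franks F Fc F0 Finj hfp (fun t => Γ (cl t)) (by fun_prop) (fun u v e => by
        have e := congrArg exp e
        rw [F1] at e
        have := tr _ (by linarith [(clm v).1]) (by linarith [(clm v).2]) _
          (by linarith [(clm u).1]) (by linarith [(clm u).2]) e.symm
        linarith [this.1, (clm v).2])
      intro h'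
      apply this
      have c0 : cl 0 = b := by
        have : b ≤ a := by linarith
        simp [hcl', this]
      have c1 : cl 1 = a := by
        have : b ≤ a := by linarith
        simp [hcl', this]
      simp only [c0, c1]
      rw [← hΓ1 b ⟨hb0, by linarith⟩, ← hΓ1 (b + 1) ⟨by linarith, by linarith⟩, ← h']
      congr 1; ring
    · intro s ⟨hsl, hsr⟩ t ⟨htl, htr⟩ e
      have := tr t (by linarith) htr s (by linarith) hsr e.symm
      linarith [this.2]
    · intro s ⟨hsl, hsr⟩ t ⟨htl, htr⟩ e
      rw [hs1 t (by linarith) (by linarith)] at e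
      have e := hhinj e
      rw [hs1 s (by linarith) (by linarith)] at e
      have := tr _ (by linarith) (by linarith) _ (by linarith) (by linarith) e.symm
      linarith [this.1]
    · intro s ⟨hsl, hsr⟩ t ⟨htl, htr⟩ e
      rw [hs1 t (by linarith) (by linarith)] at e
      have e := hhinj e
      rcases le_total t 2 with ht | ht <;> rcases le_total s 2 with hs' | hs'
      · rw [hs1 s (by linarith) (by linarith)] at e
        have := tr _ (by linarith) (by linarith) _ (by linarith) (by linarith) e.symm
        linarith [this.2]
      · have := hmin' (t - 1) (by linarith) (by linarith) (s - 2) (by linarith) (by linarith)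
          (by rw [add_sub_cancel, e])
        linarith [this.2]
      · have e := down _ _ (by linarith) (by linarith) (by linarith) (by linarith) e
        have := inj _ ⟨by linarith, by linarith⟩ _ ⟨by linarith, by linarith⟩ e
        linarith
      · have e := down _ _ (by linarith) (by linarith) (by linarith) (by linarith) e
        rw [hs1 (s - 1) (by linarith) (by linarith)] at e
        have := tr _ (by linarith) (by linarith) _ (by linarith) (by linarith) e.symm
        linarith [this.1]
  -- the arc
  refine ⟨fun t => exp (Γ (1/2 + t)), by fun_prop, ?_, by simp, ?_, ?_⟩
  · have key : ∀ s t, 0 ≤ s → s ≤ t → t ≤ 1 → exp (Γ (1/2 + s)) = exp (Γ (1/2 + t)) → s = t := by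
      intro s t h1 h2 h3 e
      rcases le_total t (1/2) with ht | ht
      · have := inj _ ⟨by linarith, by linarith⟩ _ ⟨by linarith, by linarith⟩ e
        linarith
      rcases le_total s (1/2) with hs' | hs'
      · rw [hs1 (1/2 + t) (by linarith) (by linarith)] at e
        have := tr _ (by linarith) (by linarith) _ (by linarith) (by linarith) e
        linarith [this.1, this.2]
      · have e := down _ _ (by linarith) (by linarith) (by linarith) (by linarith) e
        have := inj _ ⟨by linarith, by linarith⟩ _ ⟨by linarith, by linarith⟩ e
        linarith
    intro s hs t ht e
    rcases le_total s t with hst | hst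
    · exact key s t hs.1 hst ht.2 e
    · exact (key t s ht.1 hst hs.2 e.symm).symm
  · exact hs (1/2) (by norm_num) (by norm_num)
  · apply Subset.antisymm
    · rintro y ⟨⟨s, ⟨hs0, hs2⟩, rfl⟩, ⟨t, ⟨ht0, ht2⟩, e⟩⟩
      simp only [Function.comp_apply] at e
      simp only [mem_singleton_iff]
      rcases le_total s (1/2) with hs' | hs' <;> rcases le_total t (1/2) with ht | ht
      · have := tr _ (by linarith) (by linarith) _ (by linarith) (by linarith) e.symm
        linarith [this.2]
      · rw [← hs (1/2 + t) (by linarith) (by linarith)] at e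
        refine absurd e.symm ?_
        have := hbad (1/2 + s) (by linarith) (by linarith) (t - 1/2) (by linarith) (by linarith)
        rwa [show 2 + (t - 1/2) = 1/2 + t + 1 by ring] at this
      · rw [hs1 (1/2 + s) (by linarith) (by linarith)] at e
        have := inj _ ⟨by linarith, by linarith⟩ _ ⟨by linarith, by linarith⟩ (hhinj e)
        have hs1' : s = 1 := by linarith
        subst hs1'
        exact hs (1/2) (by norm_num) (by norm_num)
      · rw [hs1 (1/2 + s) (by linarith) (by linarith)] at e
        have e := hhinj e
        rw [hs1 (1/2 + t) (by linarith) (by linarith)] at e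
        have := tr _ (by linarith) (by linarith) _ (by linarith) (by linarith) e.symm
        linarith [this.1]
    · rintro y rfl
      refine ⟨⟨1, by norm_num, hs (1/2) (by norm_num) (by norm_num)⟩, ⟨0, by norm_num, by simp⟩⟩

open Complex in
lemma boundary (h : ℂ ≃ₜ ℂ) (h0 : h 0 = 0) (X : ℂ) (r : ℝ) (hr : 0 < r)
    (hmin : ∀ w w', h (exp w) = exp w' → r ≤ max (dist w X) (dist w' X))
    (w w' : ℂ) (hw : h (exp w) = exp w') (hwr : dist w X ≤ r) : r ≤ dist w' X := by
  by_contra hc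
  push Not at hc
  obtain ⟨H, Hc, hH, Hw⟩ := exists_log_s7 (fun w => h (exp w)) (by fun_prop)
    (fun w e => exp_ne_zero w (h.injective (e.trans h0.symm))) w w' hw.symm
  have hop : IsOpen {u | dist (H u) X < r} := isOpen_lt (by fun_prop) continuous_const
  have hcl : w ∈ closure (Metric.ball X r) := by
    rw [closure_ball X hr.ne']; exact hwr
  obtain ⟨u, hu1, hu2⟩ := mem_closure_iff.1 hcl _ hop (by simpa [Hw] using hc)
  have := hmin u (H u) (hH u).symm
  have hu1' : dist (H u) X < r := hu1
  have hu2' : dist u X < r := hu2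
  linarith [max_lt hu2' hu1']

open Complex in
lemma radius_lt (h : ℂ → ℂ) (hcont : Continuous h) (hfx : ∀ y, y ≠ 0 → h y ≠ y)
    (hmod : ∀ γ : ℝ → ℂ, IsLoopIn γ → HasDeg γ 1 → ∀ l : ℕ, Decomp h γ l → 4 ≤ l)
    (X : ℂ) (r : ℝ)
    (hmin : ∀ w w', h (exp w) = exp w' → r ≤ max (dist w X) (dist w' X)) : r < Real.pi := by
  by_contra hc
  push Not at hc
  have hpi := Real.pi_pos
  set g : ℝ → ℂ := fun s => X + s * I with hg
  have gc : Continuous g := by fun_prop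
  have hop : IsOpen {y : ℝ × ℝ | h (exp (g y.1)) ≠ exp (g y.2)} :=
    isOpen_ne_fun (by fun_prop) (by fun_prop)
  obtain ⟨δ, hδ, hball⟩ := Metric.isOpen_iff.1 hop (Real.pi, Real.pi) (hfx _ (exp_ne_zero _))
  obtain ⟨ε, hε0, hε1, hε2⟩ : ∃ ε : ℝ, 0 < ε ∧ ε < δ ∧ ε ≤ 1 :=
      ⟨min (δ / 2) 1, by positivity, by
        have := min_le_left (δ / 2) 1; linarith, min_le_right _ _⟩
  have hpi3 := Real.pi_gt_three
  have f1 : ∀ s t, |s| < Real.pi → |t| < Real.pi → h (exp (g s)) ≠ exp (g t) := by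
    intro s t hs ht e
    have := hmin _ _ e
    simp only [hg, dist_eq_norm, add_sub_cancel_left, norm_mul, norm_real, norm_I, mul_one,
      Real.norm_eq_abs] at this
    linarith [max_lt hs ht]
  have f2 : ∀ s t, |s - Real.pi| < δ → |t - Real.pi| < δ → h (exp (g s)) ≠ exp (g t) := by
    intro s t hs ht
    exact @hball (s, t) (by
      rw [Metric.mem_ball, Prod.dist_eq, Real.dist_eq, Real.dist_eq]; exact max_lt hs ht)
  have := hmod (fun t => exp (g (2 * Real.pi * t - (Real.pi - ε))))
    ⟨by fun_prop, ?_, fun t _ => exp_ne_zero _⟩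
    ⟨fun t => g (2 * Real.pi * t - (Real.pi - ε)), by fun_prop, fun _ _ => rfl, ?_⟩ 2
    ⟨fun i => if i = 0 then 0 else if i = 1 then (Real.pi - ε) / Real.pi else 1, by simp, by simp,
      ?_, ?_⟩
  · omega
  · rw [exp_eq_exp_iff_exists_int]
    exact ⟨-1, by simp only [hg]; push_cast; ring⟩
  · simp only [hg]; push_cast; ring
  · intro i hi
    interval_cases i
    · simp only [if_true]
      norm_num
      apply div_nonneg <;> linarith
    · norm_num
      rw [div_le_one hpi]; linarith
  · intro i hi
    interval_cases i
    · intro s hs t ht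
      norm_num [le_div_iff₀ hpi] at hs ht
      apply f1 <;> rw [abs_lt] <;> constructor <;> nlinarith
    · intro s hs t ht
      norm_num [div_le_iff₀ hpi] at hs ht
      apply f2 <;> rw [abs_lt] <;> constructor <;> nlinarith

open Complex in
lemma exists_curve (h : ℂ ≃ₜ ℂ) (hor : IsotopicToId ⇑h) (h0 : h 0 = 0)
    (hfx : ∀ y, y ≠ 0 → h y ≠ y)
    (hmod : ∀ γ : ℝ → ℂ, IsLoopIn γ → HasDeg γ 1 → ∀ l : ℕ, Decomp (⇑h) γ l → 4 ≤ l)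
    (X : ℂ) :
    ∃ F : ℝ → ℂ → ℂ, Continuous (Function.uncurry F) ∧ (∀ w, F 0 w = w) ∧
      (∀ s, Function.Injective (F s)) ∧ (∀ w, exp (F 1 w) = h (exp w)) ∧
    ∃ Γ : ℝ → ℂ, Continuous Γ ∧ Γ (1/2) = X ∧ Γ 1 = F 1 (Γ 0) ∧
    (∀ s ∈ Icc (0:ℝ) 1, ∀ t ∈ Icc (0:ℝ) 1, exp (Γ s) = exp (Γ t) → s = t) ∧
    (∀ s ∈ Icc (0:ℝ) 1, ∀ t ∈ Icc (0:ℝ) 1, exp (Γ s) = h (exp (Γ t)) →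
      (s = 1 ∧ t = 0) ∨ (s = 0 ∧ t = 1)) := by
  have hPcl : IsClosed {y : ℂ × ℂ | h (exp y.1) = exp y.2} :=
    isClosed_eq (by fun_prop) (by fun_prop)
  have hne : h (exp X) ≠ 0 := fun e => exp_ne_zero X (h.injective (e.trans h0.symm))
  obtain ⟨⟨z, z'⟩, hz, hzr⟩ := hPcl.exists_infDist_eq_dist
    ⟨(X, Complex.log (h (exp X))), (Complex.exp_log hne).symm⟩ (X, X)
  change h (exp z) = exp z' at hz
  obtain ⟨r, hr⟩ : ∃ r, r = Metric.infDist (X, X) {y : ℂ × ℂ | h (exp y.1) = exp y.2} := ⟨_, rfl⟩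
  rw [← hr, Prod.dist_eq] at hzr
  simp only at hzr
  have hmin : ∀ w w', h (exp w) = exp w' → r ≤ max (dist w X) (dist w' X) := by
    intro w w' hw
    have : Metric.infDist (X, X) {y : ℂ × ℂ | h (exp y.1) = exp y.2} ≤ dist (X, X) (w, w') :=
      Metric.infDist_le_dist_of_mem hw
    rw [← hr, Prod.dist_eq] at this
    simpa only [dist_comm X] using this
  have hr0 : 0 < r := by
    by_contra hc
    push Not at hc
    have h1 : dist X z ≤ 0 := by linarith [le_max_left (dist X z) (dist X z')]
    have h2 : dist X z' ≤ 0 := by linarith [le_max_right (dist X z) (dist X z')]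
    rw [dist_le_zero] at h1 h2
    subst h1; subst h2
    exact hfx _ (exp_ne_zero _) hz
  have hrpi := radius_lt h h.continuous hfx hmod X r hmin
  have bd : ∀ w w', h (exp w) = exp w' → dist w X ≤ r → dist w' X ≤ r →
      dist w X = r ∧ dist w' X = r := by
    intro w w' e h1 h2
    refine ⟨le_antisymm h1 ?_, le_antisymm h2 (boundary h h0 X r hr0 hmin w w' e h1)⟩
    refine boundary h.symm (h.injective (by simp [h0])) X r hr0 ?_ w' w (by simp [← e]) h2
    intro u u' e'
    rw [max_comm]
    exact hmin u' u (by simp [← e'])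
  obtain ⟨bz, bz'⟩ := bd z z' hz
    (by rw [hzr, dist_comm]; exact le_max_left _ _) (by rw [hzr, dist_comm z']; exact le_max_right _ _)
  rw [dist_eq_norm] at bz bz'
  obtain ⟨F, Fc, F0, Finj, F1, Fz⟩ := lift_isotopy h hor h0 z z' hz
  have hzz : z' ≠ z := by
    rintro rfl
    exact hfx _ (exp_ne_zero _) hz
  set Γ : ℝ → ℂ := fun t => X + (max (1 - 2 * t) 0 : ℝ) * (z - X) + (max (2 * t - 1) 0 : ℝ) * (z' - X)
    with hΓ
  have Γ0 : Γ 0 = z := by simp [hΓ]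
  have Γ1 : Γ 1 = z' := by norm_num [hΓ]
  have ΓL : ∀ t, t ≤ 1/2 → Γ t = X + (1 - 2 * t : ℝ) * (z - X) := by
    intro t ht
    simp only [hΓ]
    rw [max_eq_left (by linarith), max_eq_right (by linarith)]; simp
  have ΓR : ∀ t, 1/2 ≤ t → Γ t = X + (2 * t - 1 : ℝ) * (z' - X) := by
    intro t ht
    simp only [hΓ]
    rw [max_eq_right (by linarith), max_eq_left (by linarith)]; simp
  have dL : ∀ t, t ≤ 1/2 → dist (Γ t) X = (1 - 2 * t) * r := by
    intro t ht
    rw [ΓL t ht, dist_eq_norm, add_sub_cancel_left, norm_mul, norm_real, bz, Real.norm_eq_abs,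
      abs_of_nonneg (by linarith)]
  have dR : ∀ t, 1/2 ≤ t → dist (Γ t) X = (2 * t - 1) * r := by
    intro t ht
    rw [ΓR t ht, dist_eq_norm, add_sub_cancel_left, norm_mul, norm_real, bz', Real.norm_eq_abs,
      abs_of_nonneg (by linarith)]
  have dle : ∀ t ∈ Icc (0:ℝ) 1, dist (Γ t) X ≤ r := by
    intro t ht
    rcases le_total t (1/2) with h' | h'
    · rw [dL t h']; nlinarith [ht.1]
    · rw [dR t h']; nlinarith [ht.2]
  have deq : ∀ t, dist (Γ t) X = r → t = 0 ∨ t = 1 := by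
    intro t ht
    rcases le_total t (1/2) with h' | h'
    · rw [dL t h'] at ht
      left
      have : (1 - 2 * t) = 1 := mul_right_cancel₀ hr0.ne' (by linarith)
      linarith
    · rw [dR t h'] at ht
      right
      have : (2 * t - 1) = 1 := mul_right_cancel₀ hr0.ne' (by linarith)
      linarith
  refine ⟨F, Fc, F0, Finj, F1, Γ, by fun_prop, ?_, by rw [Γ0, Γ1, Fz], ?_, ?_⟩
  · rw [ΓL _ le_rfl]; norm_num
  · -- injectivity
    have inj' : ∀ s ∈ Icc (0:ℝ) 1, ∀ t ∈ Icc (0:ℝ) 1, exp (Γ s) = exp (Γ t) → Γ s = Γ t := by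
      intro s hs t ht e
      obtain ⟨n, hn⟩ := exp_eq_exp_iff_exists_int.1 e
      have hd : dist (Γ s) (Γ t) < 2 * Real.pi := by
        have := dist_triangle_right (Γ s) (Γ t) X
        linarith [dle s hs, dle t ht]
      rw [hn, dist_eq_norm, add_sub_cancel_left] at hd
      simp only [norm_mul, norm_I, mul_one, norm_real, Real.norm_eq_abs, norm_intCast,
        RCLike.norm_ofNat, abs_of_pos Real.pi_pos] at hd
      have hpos : 0 < 2 * Real.pi := by positivity
      have : |(n:ℝ)| < 1 := by
        by_contra hc
        push Not at hc
        nlinarith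
      have hn0 : n = 0 := by
        have : |n| < 1 := by exact_mod_cast this
        exact Int.abs_lt_one_iff.1 this
      rw [hn, hn0]; simp
    have key : ∀ s t, s ≤ t → Γ s = Γ t → s = t := by
      intro s t hst e
      have ed : dist (Γ s) X = dist (Γ t) X := by rw [e]
      rcases le_total t (1/2) with ht | ht
      · rw [dL s (by linarith), dL t ht] at ed
        have := mul_right_cancel₀ hr0.ne' ed
        linarith
      rcases le_total s (1/2) with hs | hs
      · rw [dL s hs, dR t ht] at ed
        have e2 := mul_right_cancel₀ hr0.ne' ed
        rw [ΓL s hs, ΓR t ht, ← e2] at e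
        have e3 := add_left_cancel e
        by_cases hc : (1 - 2 * s) = 0
        · linarith
        · have := mul_left_cancel₀ (by exact_mod_cast hc) e3
          exact absurd (sub_left_injective this).symm hzz
      · rw [dR s hs, dR t ht] at ed
        have := mul_right_cancel₀ hr0.ne' ed
        linarith
    intro s hs t ht e
    rcases le_total s t with hst | hst
    · exact key s t hst (inj' s hs t ht e)
    · exact (key t s hst (inj' s hs t ht e).symm).symm
  · intro s hs t ht e
    obtain ⟨b1, b2⟩ := bd _ _ e.symm (dle t ht) (dle s hs)
    rcases deq _ b1 with rfl | rfl <;> rcases deq _ b2 with rfl | rfl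
    · exact absurd e.symm (hfx _ (exp_ne_zero _))
    · left; simp
    · right; simp
    · exact absurd e.symm (hfx _ (exp_ne_zero _))

/-- For an orientation-preserving homeomorphism of the plane fixing only `0`, with
module at least `4`, every point `x ≠ 0` admits a translation arc: an arc `γ` from `x`
to `h x` with `γ ∩ h(γ) = {h x}`. -/
theorem stmt7 (h : ℂ ≃ₜ ℂ) (hor : IsotopicToId ⇑h)
    (hfix : ∀ x : ℂ, h x = x ↔ x = 0)
    (hmod : ∀ γ : ℝ → ℂ, IsLoopIn γ → HasDeg γ 1 → ∀ l : ℕ, Decomp (⇑h) γ l → 4 ≤ l)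
    (x : ℂ) (hx : x ≠ 0) :
    ∃ γ : ℝ → ℂ, ContinuousOn γ (Icc 0 1) ∧ InjOn γ (Icc 0 1) ∧
      γ 0 = x ∧ γ 1 = h x ∧
      (γ '' Icc (0:ℝ) 1) ∩ ((⇑h ∘ γ) '' Icc (0:ℝ) 1) = {h x} := by

  have h0 : h 0 = 0 := (hfix 0).2 rfl
  have hfx : ∀ y, y ≠ 0 → h y ≠ y := fun y hy e => hy ((hfix y).1 e)
  obtain ⟨F, Fc, F0, Finj, F1, Γ, Γc, Γh, Γ1, inj, tr⟩ :=
    exists_curve h hor h0 hfx hmod (Complex.log x)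
  have Hc : Continuous (F 1) := Fc.comp (continuous_const.prodMk continuous_id)
  -- the extended curve
  set Γ' : ℝ → ℂ := fun t => if t ≤ 1 then Γ t else if t ≤ 2 then F 1 (Γ (t - 1))
    else F 1 (F 1 (Γ (t - 2))) with hΓ'
  have E1 : ∀ t, t ≤ 1 → Γ' t = Γ t := fun t ht => by simp [hΓ', ht]
  have E2 : ∀ t, 1 ≤ t → t ≤ 2 → Γ' t = F 1 (Γ (t - 1)) := by
    intro t h1 h2
    rcases h1.eq_or_lt with rfl | h1
    · rw [E1 _ le_rfl, Γ1]; norm_num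
    · simp [hΓ', h1, h2]
  have E3 : ∀ t, 2 ≤ t → Γ' t = F 1 (F 1 (Γ (t - 2))) := by
    intro t h1
    rcases h1.eq_or_lt with rfl | h1
    · rw [E2 _ (by norm_num) le_rfl, sub_self, ← Γ1]; norm_num
    · have : 1 < t := by linarith
      simp only [hΓ', if_neg (not_le.2 h1), if_neg (not_le.2 this)]
  have Γ'c : Continuous Γ' := by
    refine Continuous.if_le Γc ?_ continuous_id continuous_const ?_
    · refine Continuous.if_le (by fun_prop) (by fun_prop) continuous_id continuous_const ?_
      rintro t rfl
      rw [sub_self, ← Γ1]; norm_num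
    · rintro t rfl
      rw [Γ1]; norm_num
  have main := main_curve h h.injective hmod hfx F Fc F0 Finj F1 Γ' Γ'c ?_ ?_ ?_
  · rw [E1 _ (by norm_num), Γh, Complex.exp_log hx] at main
    exact main
  · intro t ht
    rcases le_total t 1 with h1 | h1
    · rw [E2 (t + 1) (by linarith [ht.1]) (by linarith), E1 t h1, add_sub_cancel_right]
    · rw [E3 (t + 1) (by linarith), E2 t h1 ht.2]
      congr 3; ring
  · intro s hs t ht
    rw [E1 s hs.2, E1 t ht.2]
    exact inj s hs t ht
  · intro s hs t ht
    rw [E1 s hs.2, E1 t ht.2]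
    exact tr s hs t ht
end
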